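/- arXiv:1008.3650 — 2 statements merged into one kernel-verified Lean document; each statement's English description precedes it below -/
import Mathlib

section
/- Assume 0 ≤ λ < λ̃, and let s* ∈ (b*, ∞) be the unique root of B(s) := (r+λ)·(b̃*/s)^{θ̃} − (r+λ̃)·(b*/s)^{θ} + (λ̃ − λ). Define A := (rKθ/((r+λ)(θ+1)s*))·(b*/s*)^{θ} − (rKθ̃/((r+λ̃)(θ̃+1)s*))·(b̃*/s*)^{θ̃}. Then the continuous-fit and smooth-fit conditions hold at s*: A·s* = P̃(s*) − P(s*) and A = P̃′(s*) − P′(s*). -/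
open Real Filter

/-- `θ = 2(r+λ)/σ²`. -/
noncomputable def perpTheta (r lam sigma : ℝ) : ℝ := 2 * (r + lam) / sigma ^ 2

/-- Optimal exercise threshold `b* = 2rK/(2(r+λ) + σ²)`. -/
noncomputable def perpBstar (r lam sigma K : ℝ) : ℝ := 2 * r * K / (2 * (r + lam) + sigma ^ 2)

/-- Market price of a perpetual American put (strike `K`) on a defaultable stock
with constant default intensity `λ`. -/
noncomputable def perpPut (r lam sigma K s : ℝ) : ℝ :=
  if s ≤ perpBstar r lam sigma K then K - s
  else (r * K / ((r + lam) * (perpTheta r lam sigma + 1)))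
        * (s / perpBstar r lam sigma K) ^ (-(perpTheta r lam sigma)) + lam * K / (r + lam)

/-- The function `B(s) = (r+λ)·(b̃*/s)^{θ̃} − (r+λ̃)·(b*/s)^{θ} + (λ̃ − λ)`. -/
noncomputable def purchaseB (r lam lamt sigma K s : ℝ) : ℝ :=
  (r + lam) * (perpBstar r lamt sigma K / s) ^ perpTheta r lamt sigma
    - (r + lamt) * (perpBstar r lam sigma K / s) ^ perpTheta r lam sigma
    + (lamt - lam)

lemma perpPut_aux (r lam sigma K s : ℝ) (hr : 0 < r) (hsigma : 0 < sigma) (hK : 0 < K)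
    (hlam : 0 ≤ lam) (hs : perpBstar r lam sigma K < s) :
    perpPut r lam sigma K s = (r * K / ((r + lam) * (perpTheta r lam sigma + 1)))
        * (perpBstar r lam sigma K / s) ^ (perpTheta r lam sigma) + lam * K / (r + lam)
    ∧ deriv (fun s => perpPut r lam sigma K s) s
      = - (r * K * perpTheta r lam sigma / ((r + lam) * (perpTheta r lam sigma + 1) * s)
        * (perpBstar r lam sigma K / s) ^ (perpTheta r lam sigma)) := by
  have hb : 0 < perpBstar r lam sigma K := by unfold perpBstar; positivity
  have hθ : 0 < perpTheta r lam sigma := by unfold perpTheta; positivity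
  have hform : ∀ t, perpBstar r lam sigma K < t →
      perpPut r lam sigma K t = (r * K / ((r + lam) * (perpTheta r lam sigma + 1)))
        * (t / perpBstar r lam sigma K) ^ (-(perpTheta r lam sigma)) + lam * K / (r + lam) := by
    intro t ht
    unfold perpPut
    rw [if_neg (not_le.mpr ht)]
  have hs0 : 0 < s := hb.trans hs
  have hflip : (s / perpBstar r lam sigma K) ^ (-(perpTheta r lam sigma))
      = (perpBstar r lam sigma K / s) ^ (perpTheta r lam sigma) := by
    rw [Real.rpow_neg (by positivity), ← Real.inv_rpow (by positivity), inv_div]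
  refine ⟨by rw [hform s hs, hflip], ?_⟩
  have hev : (fun s => perpPut r lam sigma K s) =ᶠ[nhds s]
      fun t => (r * K / ((r + lam) * (perpTheta r lam sigma + 1)))
        * (t / perpBstar r lam sigma K) ^ (-(perpTheta r lam sigma)) + lam * K / (r + lam) := by
    filter_upwards [lt_mem_nhds hs] with t ht using hform t ht
  rw [hev.deriv_eq]
  have hd := ((((hasDerivAt_id s).div_const (perpBstar r lam sigma K)).rpow_const
    (p := -(perpTheta r lam sigma)) (Or.inl (by simp only [id]; positivity))).const_mul
    (r * K / ((r + lam) * (perpTheta r lam sigma + 1)))).add_const (lam * K / (r + lam))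
  simp only [id] at hd
  rw [hd.deriv, Real.rpow_sub_one (by positivity), hflip]
  have h1 : r + lam ≠ 0 := by positivity
  have h2 : perpTheta r lam sigma + 1 ≠ 0 := by positivity
  field_simp

/-- **Continuous fit and smooth fit at the purchase threshold `s*`
(Proposition 3.7).**  Assume `0 ≤ λ < λ̃`, let `s* ∈ (b*, ∞)` be a root of `B`,
and let
`A = (rKθ/((r+λ)(θ+1)s*))·(b*/s*)^θ − (rKθ̃/((r+λ̃)(θ̃+1)s*))·(b̃*/s*)^θ̃`.
Then `A·s* = P̃(s*) − P(s*)` and `A = P̃′(s*) − P′(s*)`. -/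
theorem perpPut_continuous_smooth_fit
    (r lam lamt sigma K : ℝ) (hr : 0 < r) (hsigma : 0 < sigma) (hK : 0 < K)
    (hlam : 0 ≤ lam) (hlt : lam < lamt)
    (sstar : ℝ) (hsstar : sstar ∈ Set.Ioi (perpBstar r lam sigma K))
    (hroot : purchaseB r lam lamt sigma K sstar = 0)
    (A : ℝ)
    (hA : A = r * K * perpTheta r lam sigma
            / ((r + lam) * (perpTheta r lam sigma + 1) * sstar)
            * (perpBstar r lam sigma K / sstar) ^ perpTheta r lam sigma
          - r * K * perpTheta r lamt sigma
            / ((r + lamt) * (perpTheta r lamt sigma + 1) * sstar)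
            * (perpBstar r lamt sigma K / sstar) ^ perpTheta r lamt sigma) :
    A * sstar = perpPut r lamt sigma K sstar - perpPut r lam sigma K sstar
    ∧ A = deriv (fun s => perpPut r lamt sigma K s) sstar
          - deriv (fun s => perpPut r lam sigma K s) sstar := by
  have hlamt : 0 ≤ lamt := hlam.trans hlt.le
  have hs : perpBstar r lam sigma K < sstar := hsstar
  have hb : 0 < perpBstar r lam sigma K := by unfold perpBstar; positivity
  have hs0 : 0 < sstar := hb.trans hs
  have hbb : perpBstar r lamt sigma K < sstar := by
    refine lt_of_le_of_lt ?_ hs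
    unfold perpBstar
    gcongr
  obtain ⟨h1, h2⟩ := perpPut_aux r lam sigma K sstar hr hsigma hK hlam hs
  obtain ⟨h3, h4⟩ := perpPut_aux r lamt sigma K sstar hr hsigma hK hlamt hbb
  refine ⟨?_, by rw [h2, h4, hA]; ring⟩
  rw [h1, h3, hA]
  have hθ : 0 < perpTheta r lam sigma := by unfold perpTheta; positivity
  have hθt : 0 < perpTheta r lamt sigma := by unfold perpTheta; positivity
  unfold purchaseB at hroot
  generalize (perpBstar r lam sigma K / sstar) ^ perpTheta r lam sigma = x at *
  generalize (perpBstar r lamt sigma K / sstar) ^ perpTheta r lamt sigma = y at *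
  generalize perpTheta r lam sigma = a at *
  generalize perpTheta r lamt sigma = b at *
  have e1 : r + lam ≠ 0 := by positivity
  have e2 : r + lamt ≠ 0 := by positivity
  have e3 : a + 1 ≠ 0 := by positivity
  have e4 : b + 1 ≠ 0 := by positivity
  field_simp
  linear_combination (-(r * (a + 1) * (b + 1))) * hroot
end

section
/- Assume 0 ≤ λ < λ̃, let s* ∈ (b*, ∞) be the unique root of B(s) := (r+λ)·(b̃*/s)^{θ̃} − (r+λ̃)·(b*/s)^{θ} + (λ̃ − λ), and let A := (rKθ/((r+λ)(θ+1)s*))·(b*/s*)^{θ} − (rKθ̃/((r+λ̃)(θ̃+1)s*))·(b̃*/s*)^{θ̃}. Define Ĵ(s) := A·s for 0 < s < s* and Ĵ(s) := P̃(s) − P(s) for s ≥ s*. Then Ĵ satisfies the variational inequality: (i) Ĵ is continuous and concave on (0,∞) with Ĵ(0⁺) = 0; (ii) Ĵ(s) ≥ P̃(s) − P(s) for all s > 0, with equality for s ≥ s*; (iii) for 0 < s < s*, (σ²s²/2)·Ĵ″(s) + (r+λ̃)·s·Ĵ′(s) − (r+λ̃)·Ĵ(s) = 0; and (iv) for s >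 s*, (σ²s²/2)·Ĵ″(s) + (r+λ̃)·s·Ĵ′(s) − (r+λ̃)·Ĵ(s) ≤ 0. -/
open Real Filter

/-- Candidate value `Ĵ` of the buyer's timing option:
`Ĵ(s) = A·s` for `0 < s < s*` and `Ĵ(s) = P̃(s) − P(s)` for `s ≥ s*`. -/
noncomputable def Jhat (r lam lamt sigma K sstar A s : ℝ) : ℝ :=
  if s < sstar then A * s else perpPut r lamt sigma K s - perpPut r lam sigma K s

noncomputable def auxQ (b θ s : ℝ) : ℝ := (s / b) ^ (-θ)

lemma auxQ_deriv {b θ s : ℝ} (hb : 0 < b) (hs : 0 < s) :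
    HasDerivAt (auxQ b θ) (-θ * auxQ b θ s / s) s := by
  have h1 : HasDerivAt (fun s : ℝ => s / b) (1 / b) s := (hasDerivAt_id s).div_const b
  have h2 := h1.rpow_const (p := -θ) (Or.inl (by positivity))
  have h3 : (s / b) ^ (-θ - 1) = (s / b) ^ (-θ) / (s / b) := by
    rw [rpow_sub_one (by positivity)]
  unfold auxQ
  convert h2 using 1
  rw [h3]
  field_simp

lemma auxQ_pos {b θ s : ℝ} (hb : 0 < b) (hs : 0 < s) : 0 < auxQ b θ s := by
  unfold auxQ; positivity

lemma auxQ_le_one {b θ s : ℝ} (hb : 0 < b) (hθ : 0 < θ) (hs : b ≤ s) : auxQ b θ s ≤ 1 :=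
  rpow_le_one_of_one_le_of_nonpos ((one_le_div hb).2 hs) (by linarith)

lemma auxQ_self {b θ : ℝ} (hb : 0 < b) : auxQ b θ b = 1 := by
  unfold auxQ; rw [div_self hb.ne', one_rpow]

lemma auxQ_eq {b θ s : ℝ} (hb : 0 < b) (hs : 0 < s) : (b / s) ^ θ = auxQ b θ s := by
  unfold auxQ
  rw [rpow_neg (by positivity), ← inv_rpow (by positivity), inv_div]

lemma auxQ_le {b θ b' θ' s : ℝ} (hb : 0 < b) (hb' : 0 < b') (hbb : b' < b) (hθ' : 0 < θ')
    (hθθ : θ < θ') (hs : b ≤ s) : auxQ b' θ' s ≤ auxQ b θ s := by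
  have hs0 : 0 < s := by linarith
  unfold auxQ
  calc (s / b') ^ (-θ') ≤ (s / b) ^ (-θ') :=
        rpow_le_rpow_of_nonpos (by positivity) (by gcongr) (by linarith)
    _ ≤ _ := rpow_le_rpow_of_exponent_le ((one_le_div hb).2 hs) (by linarith)

noncomputable def auxF (b θ b' θ' C s : ℝ) : ℝ :=
  b' / θ' * auxQ b' θ' s - b / θ * auxQ b θ s + C

noncomputable def auxG (b θ b' θ' s : ℝ) : ℝ :=
  (b * auxQ b θ s - b' * auxQ b' θ' s) / s

lemma auxF_deriv {b θ b' θ' C s : ℝ} (hb : 0 < b) (hb' : 0 < b') (hθ : 0 < θ) (hθ' : 0 < θ')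
    (hs : 0 < s) : HasDerivAt (auxF b θ b' θ' C) (auxG b θ b' θ' s) s := by
  have h := (((auxQ_deriv (θ := θ') hb' hs).const_mul (b' / θ')).sub
    ((auxQ_deriv (θ := θ) hb hs).const_mul (b / θ))).add_const C
  refine HasDerivAt.congr_deriv (f := auxF b θ b' θ' C) h ?_
  unfold auxG
  field_simp
  ring

lemma auxG_deriv {b θ b' θ' L s : ℝ} (hb : 0 < b) (hb' : 0 < b')
    (hs : 0 < s) (hL : b * (θ + 1) = L) (hL' : b' * (θ' + 1) = L) :
    HasDerivAt (auxG b θ b' θ') (L * (auxQ b' θ' s - auxQ b θ s) / s ^ 2) s := by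
  have h := (((auxQ_deriv (θ := θ) hb hs).const_mul b).sub
    ((auxQ_deriv (θ := θ') hb' hs).const_mul b')).div (hasDerivAt_id s) hs.ne'
  refine HasDerivAt.congr_deriv (f := auxG b θ b' θ') h ?_
  simp only [id, Pi.sub_apply]
  field_simp
  linear_combination -(auxQ b θ s * hL) + auxQ b' θ' s * hL'

lemma auxG_anti {b θ b' θ' L : ℝ} (hb : 0 < b) (hb' : 0 < b') (hbb : b' < b) (hθ' : 0 < θ')
    (hθθ : θ < θ') (hL0 : 0 < L)
    (hL : b * (θ + 1) = L) (hL' : b' * (θ' + 1) = L) :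
    AntitoneOn (auxG b θ b' θ') (Set.Ici b) := by
  have hd : ∀ s ∈ Set.Ici b, HasDerivAt (auxG b θ b' θ')
      (L * (auxQ b' θ' s - auxQ b θ s) / s ^ 2) s := fun s hs =>
    auxG_deriv hb hb' (lt_of_lt_of_le hb hs) hL hL'
  apply antitoneOn_of_deriv_nonpos (convex_Ici b)
  · exact fun s hs => (hd s hs).continuousAt.continuousWithinAt
  · intro s hs
    exact (hd s (interior_subset hs)).differentiableAt.differentiableWithinAt
  · intro s hs
    have hs' := interior_subset hs
    rw [(hd s hs').deriv]
    have := auxQ_le hb hb' hbb hθ' hθθ hs'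
    apply div_nonpos_of_nonpos_of_nonneg _ (by positivity)
    nlinarith

/-- tangent line bound -/
lemma auxF_tangent {b θ b' θ' L C t s : ℝ} (hb : 0 < b) (hb' : 0 < b') (hbb : b' < b)
    (hθ : 0 < θ) (hθ' : 0 < θ') (hθθ : θ < θ') (hL0 : 0 < L)
    (hL : b * (θ + 1) = L) (hL' : b' * (θ' + 1) = L)
    (ht : auxF b θ b' θ' C t = auxG b θ b' θ' t * t) (hs : b ≤ s) (hst : s ≤ t) :
    auxF b θ b' θ' C s ≤ auxG b θ b' θ' t * s := by
  have hG := auxG_anti hb hb' hbb hθ' hθθ hL0 hL hL'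
  have hd : ∀ x ∈ Set.Icc b t, HasDerivAt
      (fun x => auxF b θ b' θ' C x - auxG b θ b' θ' t * x)
      (auxG b θ b' θ' x - auxG b θ b' θ' t * 1) x := fun x hx =>
    (auxF_deriv hb hb' hθ hθ' (lt_of_lt_of_le hb hx.1)).sub ((hasDerivAt_id x).const_mul _)
  have hm : MonotoneOn (fun x => auxF b θ b' θ' C x - auxG b θ b' θ' t * x) (Set.Icc b t) := by
    apply monotoneOn_of_deriv_nonneg (convex_Icc b t)
    · exact fun s hs => (hd s hs).continuousAt.continuousWithinAt
    · intro s hs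
      exact (hd s (interior_subset hs)).differentiableAt.differentiableWithinAt
    · intro s hs
      have hs' := interior_subset hs
      rw [(hd s hs').deriv]
      have := hG hs'.1 (hs'.1.trans hs'.2) hs'.2
      linarith
  have := hm ⟨hs, hst⟩ ⟨hs.trans hst, le_rfl⟩ hst
  simp only at this
  linarith

lemma auxQ_convex {b θ : ℝ} (hb : 0 < b) (hθ : 0 < θ) : ConvexOn ℝ (Set.Ioi 0) (auxQ b θ) := by
  have hd : ∀ s ∈ Set.Ioi (0:ℝ), HasDerivAt (auxQ b θ) (-θ * auxQ b θ s / s) s :=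
    fun s hs => auxQ_deriv hb hs
  apply MonotoneOn.convexOn_of_deriv (convex_Ioi 0)
  · exact fun s hs => (hd s hs).continuousAt.continuousWithinAt
  · intro s hs
    exact (hd s (interior_subset hs)).differentiableAt.differentiableWithinAt
  · rw [interior_Ioi]
    intro s hs t ht hst
    have hs0 : 0 < s := hs
    have ht0 : 0 < t := ht
    rw [(hd s hs).deriv, (hd t ht).deriv]
    have h1 : auxQ b θ t ≤ auxQ b θ s := by
      unfold auxQ
      exact rpow_le_rpow_of_nonpos (by positivity) (by gcongr) (by linarith)
    have h2 : auxQ b θ t / t ≤ auxQ b θ s / s := by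
      have := auxQ_pos (θ := θ) hb ht0
      have := auxQ_pos (θ := θ) hb hs0
      gcongr
    rw [mul_div_assoc, mul_div_assoc]
    nlinarith

lemma perp_facts {r lam sigma K : ℝ} (hr : 0 < r) (hsigma : 0 < sigma) (hK : 0 < K)
    (hlam : 0 ≤ lam) : 0 < perpTheta r lam sigma ∧ 0 < perpBstar r lam sigma K ∧
    perpBstar r lam sigma K * (perpTheta r lam sigma + 1) = 2 * r * K / sigma ^ 2 ∧
    r * K / ((r + lam) * (perpTheta r lam sigma + 1))
      = perpBstar r lam sigma K / perpTheta r lam sigma ∧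
    r + lam = sigma ^ 2 / 2 * perpTheta r lam sigma := by
  have : 0 < r + lam := by linarith
  unfold perpTheta perpBstar
  refine ⟨by positivity, by positivity, ?_, ?_, ?_⟩ <;> field_simp

lemma perpPut_gt {r lam sigma K s : ℝ} (hr : 0 < r) (hsigma : 0 < sigma) (hK : 0 < K)
    (hlam : 0 ≤ lam) (hs : perpBstar r lam sigma K ≤ s) :
    perpPut r lam sigma K s = perpBstar r lam sigma K / perpTheta r lam sigma *
      auxQ (perpBstar r lam sigma K) (perpTheta r lam sigma) s + lam * K / (r + lam) := by
  obtain ⟨h1, h2, h3, h4, h5⟩ := perp_facts hr hsigma hK hlam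
  unfold perpPut
  split_ifs with h
  · have : s = perpBstar r lam sigma K := le_antisymm h hs
    rw [this, auxQ_self h2]
    have : 0 < r + lam := by linarith
    unfold perpTheta perpBstar
    field_simp
    ring
  · rw [h4]; rfl

/-- **Variational inequality for the timing-option value (Proposition 3.7).**
Assume `0 ≤ λ < λ̃`, `s* ∈ (b*, ∞)` is the root of `B`, and `A` is as in the
smooth-fit construction.  Then: (i) `Ĵ` is continuous and concave on `(0,∞)`
with `Ĵ(0⁺) = 0`; (ii) `Ĵ(s) ≥ P̃(s) − P(s)` for all `s > 0`, with equality for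
`s ≥ s*`; (iii) for `0 < s < s*`, `(σ²s²/2)Ĵ″ + (r+λ̃)sĴ′ − (r+λ̃)Ĵ = 0`; and
(iv) for `s > s*`, `(σ²s²/2)Ĵ″ + (r+λ̃)sĴ′ − (r+λ̃)Ĵ ≤ 0`. -/
theorem Jhat_variational_inequality
    (r lam lamt sigma K : ℝ) (hr : 0 < r) (hsigma : 0 < sigma) (hK : 0 < K)
    (hlam : 0 ≤ lam) (hlt : lam < lamt)
    (sstar : ℝ) (hsstar : sstar ∈ Set.Ioi (perpBstar r lam sigma K))
    (hroot : purchaseB r lam lamt sigma K sstar = 0)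
    (A : ℝ)
    (hA : A = r * K * perpTheta r lam sigma
            / ((r + lam) * (perpTheta r lam sigma + 1) * sstar)
            * (perpBstar r lam sigma K / sstar) ^ perpTheta r lam sigma
          - r * K * perpTheta r lamt sigma
            / ((r + lamt) * (perpTheta r lamt sigma + 1) * sstar)
            * (perpBstar r lamt sigma K / sstar) ^ perpTheta r lamt sigma) :
    (ContinuousOn (fun s => Jhat r lam lamt sigma K sstar A s) (Set.Ioi 0)
      ∧ ConcaveOn ℝ (Set.Ioi 0) (fun s => Jhat r lam lamt sigma K sstar A s)
      ∧ Tendsto (fun s => Jhat r lam lamt sigma K sstar A s)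
          (nhdsWithin 0 (Set.Ioi 0)) (nhds 0))
    ∧ (∀ s ∈ Set.Ioi (0 : ℝ),
        perpPut r lamt sigma K s - perpPut r lam sigma K s
            ≤ Jhat r lam lamt sigma K sstar A s
          ∧ (sstar ≤ s →
              Jhat r lam lamt sigma K sstar A s
                = perpPut r lamt sigma K s - perpPut r lam sigma K s))
    ∧ (∀ s ∈ Set.Ioo (0 : ℝ) sstar,
        sigma ^ 2 * s ^ 2 / 2
            * deriv (deriv (fun x => Jhat r lam lamt sigma K sstar A x)) s
          + (r + lamt) * s * deriv (fun x => Jhat r lam lamt sigma K sstar A x) s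
          - (r + lamt) * Jhat r lam lamt sigma K sstar A s = 0)
    ∧ (∀ s ∈ Set.Ioi sstar,
        sigma ^ 2 * s ^ 2 / 2
            * deriv (deriv (fun x => Jhat r lam lamt sigma K sstar A x)) s
          + (r + lamt) * s * deriv (fun x => Jhat r lam lamt sigma K sstar A x) s
          - (r + lamt) * Jhat r lam lamt sigma K sstar A s ≤ 0) := by
  obtain ⟨hθ, hb, hL, hc, ha⟩ := perp_facts hr hsigma hK hlam
  have hlamt : 0 ≤ lamt := by linarith
  obtain ⟨hθ', hb', hL', hc', ha'⟩ := perp_facts hr hsigma hK hlamt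
  have hPut := fun s => perpPut_gt (s := s) hr hsigma hK hlam
  have hPut' := fun s => perpPut_gt (s := s) hr hsigma hK hlamt
  have hPle : ∀ s, s ≤ perpBstar r lam sigma K → perpPut r lam sigma K s = K - s := by
    intro s hs; unfold perpPut; rw [if_pos hs]
  have hPle' : ∀ s, s ≤ perpBstar r lamt sigma K → perpPut r lamt sigma K s = K - s := by
    intro s hs; unfold perpPut; rw [if_pos hs]
  have hbb : perpBstar r lamt sigma K < perpBstar r lam sigma K := by
    unfold perpBstar; gcongr
  have hθθ : perpTheta r lam sigma < perpTheta r lamt sigma := by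
    unfold perpTheta; gcongr
  have hJ1 : ∀ s, s < sstar → Jhat r lam lamt sigma K sstar A s = A * s := by
    intro s hs; unfold Jhat; rw [if_pos hs]
  have hJ2 : ∀ s, sstar ≤ s → Jhat r lam lamt sigma K sstar A s =
      perpPut r lamt sigma K s - perpPut r lam sigma K s := by
    intro s hs; unfold Jhat; rw [if_neg (not_lt.2 hs)]
  unfold purchaseB at hroot
  simp only [Set.mem_Ioi] at hsstar
  have hss0 : 0 < sstar := hb.trans hsstar
  rw [auxQ_eq hb hss0, auxQ_eq hb' hss0] at hroot hA
  generalize perpBstar r lam sigma K = b at *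
  generalize perpBstar r lamt sigma K = b' at *
  generalize perpTheta r lam sigma = θ at *
  generalize perpTheta r lamt sigma = θ' at *
  have hr1 : 0 < r + lam := by linarith
  have hr2 : 0 < r + lamt := by linarith
  obtain ⟨m, hm⟩ : ∃ m, m = sigma ^ 2 / 2 := ⟨_, rfl⟩
  have hm0 : 0 < m := by rw [hm]; positivity
  have hLm : 2 * r * K / sigma ^ 2 = r * K / m := by rw [hm]; field_simp
  rw [hLm] at hL hL'
  rw [← hm] at ha ha'
  obtain ⟨C, hC⟩ : ∃ C, C = lamt * K / (r + lamt) - lam * K / (r + lam) := ⟨_, rfl⟩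
  have hL0 : 0 < r * K / m := by positivity
  have hD : ∀ s, b ≤ s → perpPut r lamt sigma K s - perpPut r lam sigma K s
      = auxF b θ b' θ' C s := by
    intro s hs
    rw [hPut s hs, hPut' s (by linarith), hC]; unfold auxF; ring
  have hAG : A = auxG b θ b' θ' sstar := by
    have e1 : r * K * θ / ((r + lam) * (θ + 1) * sstar) = b / sstar := by
      have : r * K * θ / ((r + lam) * (θ + 1) * sstar)
        = (r * K / ((r + lam) * (θ + 1))) * θ / sstar := by field_simp
      rw [this, hc]; field_simp
    have e2 : r * K * θ' / ((r + lamt) * (θ' + 1) * sstar) = b' / sstar := by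
      have : r * K * θ' / ((r + lamt) * (θ' + 1) * sstar)
        = (r * K / ((r + lamt) * (θ' + 1))) * θ' / sstar := by field_simp
      rw [this, hc']; field_simp
    rw [hA, e1, e2]; unfold auxG; ring
  -- key algebra
  have k1 : b + b / θ = r * K / (r + lam) := by
    have : b + b / θ = b * (θ + 1) / θ := by field_simp
    rw [this, hL, ha]; field_simp
  have k2 : b' + b' / θ' = r * K / (r + lamt) := by
    have : b' + b' / θ' = b' * (θ' + 1) / θ' := by field_simp
    rw [this, hL', ha']; field_simp
  have hCC : C = r * K / (r + lam) / (r + lamt) * (lamt - lam) := by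
    rw [hC]; field_simp; ring
  have hGs : ∀ s, 0 < s → auxG b θ b' θ' s * s = b * auxQ b θ s - b' * auxQ b' θ' s := by
    intro s hs; unfold auxG; field_simp
  have hfit : auxF b θ b' θ' C sstar = auxG b θ b' θ' sstar * sstar := by
    rw [hGs _ hss0]
    unfold auxF
    have : (b + b / θ) * auxQ b θ sstar - (b' + b' / θ') * auxQ b' θ' sstar = C := by
      rw [k1, k2, hCC]
      field_simp
      linear_combination -hroot
    linarith
  have hA0 : 0 ≤ A := by
    rw [hAG]; unfold auxG
    apply div_nonneg _ hss0.le
    have h1 := auxQ_le hb hb' hbb hθ' hθθ hsstar.le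
    have h2 := auxQ_pos (θ := θ') hb' hss0
    nlinarith
  have hanti := auxG_anti hb hb' hbb hθ' hθθ hL0 hL hL'
  have hlow : Set.EqOn (fun s => Jhat r lam lamt sigma K sstar A s) (fun s => A * s)
      (Set.Iic sstar) := by
    intro s hs
    rcases lt_or_eq_of_le (Set.mem_Iic.1 hs) with h | h
    · exact hJ1 s h
    · simp only
      rw [h, hJ2 _ le_rfl, hD _ hsstar.le, hfit, hAG]
  have hhigh : Set.EqOn (fun s => Jhat r lam lamt sigma K sstar A s) (auxF b θ b' θ' C)
      (Set.Ici sstar) := by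
    intro s hs
    simp only
    rw [hJ2 _ hs, hD _ (hsstar.le.trans hs)]
  have hder1 : ∀ s, s < sstar →
      HasDerivAt (fun s => Jhat r lam lamt sigma K sstar A s) A s := by
    intro s hs
    have h : HasDerivAt (fun s => A * s) A s := by
      simpa using (hasDerivAt_id s).const_mul A
    apply h.congr_of_eventuallyEq
    filter_upwards [Iio_mem_nhds hs] with x hx using hlow (Set.mem_Iic.2 (le_of_lt hx))
  have hder2 : ∀ s, sstar < s →
      HasDerivAt (fun s => Jhat r lam lamt sigma K sstar A s) (auxG b θ b' θ' s) s := by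
    intro s hs
    apply (auxF_deriv (C := C) hb hb' hθ hθ' (hss0.trans hs)).congr_of_eventuallyEq
    filter_upwards [Ioi_mem_nhds hs] with x hx using hhigh (Set.mem_Ici.2 (le_of_lt hx))
  have hder3 : HasDerivAt (fun s => Jhat r lam lamt sigma K sstar A s) A sstar := by
    rw [← hasDerivWithinAt_univ, ← Set.Iic_union_Ici (a := sstar)]
    apply HasDerivWithinAt.union
    · have h : HasDerivAt (fun s => A * s) A sstar := by
        simpa using (hasDerivAt_id sstar).const_mul A
      exact h.hasDerivWithinAt.congr hlow (hlow Set.self_mem_Iic)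
    · have h := auxF_deriv (C := C) hb hb' hθ hθ' hss0
      rw [← hAG] at h
      exact h.hasDerivWithinAt.congr hhigh (hhigh Set.self_mem_Ici)
  have hder : ∀ s, HasDerivAt (fun s => Jhat r lam lamt sigma K sstar A s)
      (auxG b θ b' θ' (max s sstar)) s := by
    intro s
    rcases lt_trichotomy s sstar with h | h | h
    · rw [max_eq_right h.le, ← hAG]; exact hder1 s h
    · rw [h, max_self, ← hAG]; exact hder3
    · rw [max_eq_left h.le]; exact hder2 s h
  have hcont : Continuous (fun s => Jhat r lam lamt sigma K sstar A s) :=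
    continuous_iff_continuousAt.2 fun s => (hder s).continuousAt
  have hderiv : deriv (fun s => Jhat r lam lamt sigma K sstar A s)
      = fun s => auxG b θ b' θ' (max s sstar) := funext fun s => (hder s).deriv
  refine ⟨⟨hcont.continuousOn, ?_, ?_⟩, ?_, ?_, ?_⟩
  · apply AntitoneOn.concaveOn_of_deriv (convex_Ioi 0) hcont.continuousOn
    · exact fun s _ => (hder s).differentiableAt.differentiableWithinAt
    · rw [hderiv]
      intro s _ t _ hst
      exact hanti (hsstar.le.trans (le_max_right _ _)) (hsstar.le.trans (le_max_right _ _))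
        (max_le_max_right _ hst)
  · have h0 : Jhat r lam lamt sigma K sstar A 0 = 0 := by
      have := hlow (Set.mem_Iic.2 hss0.le)
      simpa using this
    have := hcont.tendsto 0
    rw [h0] at this
    exact this.mono_left nhdsWithin_le_nhds
  · intro s hs
    have hs0 : 0 < s := hs
    refine ⟨?_, hJ2 s⟩
    rcases le_or_gt sstar s with h | h
    · rw [hJ2 s h]
    rw [hJ1 s h]
    have htan : ∀ s, b ≤ s → s ≤ sstar → auxF b θ b' θ' C s ≤ A * s := by
      intro s h1 h2
      rw [hAG]
      exact auxF_tangent hb hb' hbb hθ hθ' hθθ hL0 hL hL' hfit h1 h2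
    rcases le_or_gt b s with h1 | h1
    · rw [hD s h1]; exact htan s h1 h.le
    rcases le_or_gt s b' with h2 | h2
    · rw [hPle s h1.le, hPle' s h2]
      have := mul_nonneg hA0 hs0.le
      linarith
    · have hconv : ConvexOn ℝ (Set.Ioi 0) (fun x => b' / θ' * auxQ b' θ' x
          + (lamt * K / (r + lamt) - K) + (1 - A) * x) := by
        have e1 := (auxQ_convex hb' hθ').smul (c := b' / θ') (by positivity)
        have e2 := e1.add_const (lamt * K / (r + lamt) - K)
        have e3 : ConvexOn ℝ (Set.Ioi (0:ℝ)) (fun x => (1 - A) * x) := by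
          refine ⟨convex_Ioi 0, fun x _ y _ p q _ _ _ => ?_⟩
          simp only [smul_eq_mul]
          apply le_of_eq; ring
        exact e2.add e3
      have hmax := hconv.le_max_of_mem_Icc (x := b') (y := b) (z := s) hb' hb ⟨h2.le, h1.le⟩
      have v : ∀ x, b' ≤ x → x ≤ b → b' / θ' * auxQ b' θ' x
          + (lamt * K / (r + lamt) - K) + (1 - A) * x
          = perpPut r lamt sigma K x - perpPut r lam sigma K x - A * x := by
        intro x hx1 hx2
        rw [hPut' x hx1, hPle x hx2]; ring
      rw [v s h2.le h1.le, v b' le_rfl hbb.le, v b hbb.le le_rfl] at hmax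
      have q1 : perpPut r lamt sigma K b' - perpPut r lam sigma K b' - A * b' ≤ 0 := by
        rw [hPle' b' le_rfl, hPle b' hbb.le]
        have := mul_nonneg hA0 hb'.le
        linarith
      have q2 : perpPut r lamt sigma K b - perpPut r lam sigma K b - A * b ≤ 0 := by
        rw [hD b le_rfl]
        have := htan b le_rfl hsstar.le
        linarith
      have := hmax.trans (max_le q1 q2)
      linarith
  · intro s hs
    have hd2 : HasDerivAt (fun s => auxG b θ b' θ' (max s sstar)) 0 s := by
      apply (hasDerivAt_const s A).congr_of_eventuallyEq
      filter_upwards [Iio_mem_nhds hs.2] with x hx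
      rw [max_eq_right (le_of_lt hx), hAG]
    rw [(hder1 s hs.2).deriv, hderiv, hd2.deriv, hJ1 s hs.2]
    ring
  · intro s hs
    have hs' : sstar < s := hs
    have hs0 : 0 < s := hss0.trans hs'
    have hbs : b ≤ s := (hsstar.trans hs').le
    have hd2 : HasDerivAt (fun s => auxG b θ b' θ' (max s sstar))
        (r * K / m * (auxQ b' θ' s - auxQ b θ s) / s ^ 2) s := by
      apply (auxG_deriv hb hb' hs0 hL hL').congr_of_eventuallyEq
      filter_upwards [Ioi_mem_nhds hs'] with x hx
      rw [max_eq_left (le_of_lt hx)]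
    rw [(hder2 s hs').deriv, hderiv, hd2.deriv, hJ2 s hs'.le, hD s hbs]
    have hx1 := auxQ_le_one hb hθ hbs
    have e1 : sigma ^ 2 * s ^ 2 / 2 * (r * K / m * (auxQ b' θ' s - auxQ b θ s) / s ^ 2)
        = r * K * (auxQ b' θ' s - auxQ b θ s) := by
      have : sigma ^ 2 * s ^ 2 / 2 = m * s ^ 2 := by rw [hm]; ring
      rw [this]; field_simp
    have e2 : (r + lamt) * s * auxG b θ b' θ' s
        = (r + lamt) * (b * auxQ b θ s - b' * auxQ b' θ' s) := by
      rw [← hGs s hs0]; ring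
    have e3 : r * K * (auxQ b' θ' s - auxQ b θ s)
        + (r + lamt) * (b * auxQ b θ s - b' * auxQ b' θ' s)
        - (r + lamt) * auxF b θ b' θ' C s
        = r * K / (r + lam) * (lamt - lam) * (auxQ b θ s - 1) := by
      have : r * K * (auxQ b' θ' s - auxQ b θ s)
        + (r + lamt) * (b * auxQ b θ s - b' * auxQ b' θ' s)
        - (r + lamt) * auxF b θ b' θ' C s = r * K * (auxQ b' θ' s - auxQ b θ s)
        + (r + lamt) * ((b + b / θ) * auxQ b θ s - (b' + b' / θ') * auxQ b' θ' s - C) := by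
        unfold auxF; ring
      rw [this, k1, k2, hCC]
      field_simp
      ring
    rw [e1, e2, e3]
    apply mul_nonpos_of_nonneg_of_nonpos
    · have : 0 < lamt - lam := by linarith
      positivity
    · linarith
end
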